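/- Let u ∈ ℝ^n be a unit vector and x ∈ ℝ^n an arbitrary vector. If a and b are independent standard Gaussian random vectors in ℝ^n, then E[ sign((⟨a,u⟩)^2 − (⟨b,u⟩)^2) · ((⟨a,x⟩)^2 − (⟨b,x⟩)^2) ] = (4/π) ⟨u, x⟩^2. -/

import Mathlib

open MeasureTheory ProbabilityTheory Real

lemma spe_sign_mul_self (r : ℝ) : Real.sign r * r = |r| := by
  rcases lt_trichotomy r 0 with h | h | h
  · rw [Real.sign_of_neg h, abs_of_neg h]; ring
  · simp [h]
  · rw [Real.sign_of_pos h, abs_of_pos h]; ring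

lemma spe_sign_mul (r s : ℝ) : Real.sign (r * s) = Real.sign r * Real.sign s := by
  rcases lt_trichotomy r 0 with h | h | h <;> rcases lt_trichotomy s 0 with k | k | k
  · rw [Real.sign_of_neg h, Real.sign_of_neg k, Real.sign_of_pos (mul_pos_of_neg_of_neg h k)]; ring
  · simp [k]
  · rw [Real.sign_of_neg h, Real.sign_of_pos k, Real.sign_of_neg (mul_neg_of_neg_of_pos h k)]; ring
  · simp [h]
  · simp [h]
  · simp [h]
  · rw [Real.sign_of_pos h, Real.sign_of_neg k, Real.sign_of_neg (mul_neg_of_pos_of_neg h k)]; ring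
  · simp [k]
  · rw [Real.sign_of_pos h, Real.sign_of_pos k, Real.sign_of_pos (mul_pos h k)]; ring

lemma spe_measurable_sign : Measurable Real.sign := by
  unfold Real.sign
  exact Measurable.ite measurableSet_Iio measurable_const
    (Measurable.ite measurableSet_Ioi measurable_const measurable_const)

lemma spe_sign_bound (r : ℝ) : ‖Real.sign r‖ ≤ 1 := by
  rcases Real.sign_apply_eq r with h | h | h <;> simp [h]

lemma spe_abs_gaussian : ∫ x, |x| ∂(gaussianReal 0 2) = 2 / √π := by
  rw [integral_gaussianReal_eq_integral_smul (by norm_num)]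
  have h1 : ∀ x : ℝ, gaussianPDFReal 0 2 x • |x|
      = (fun y : ℝ => (2 * √π)⁻¹ * (y ^ (1 : ℝ) * rexp (-(1 / 4) * y ^ (2 : ℝ)))) |x| := by
    intro x
    have h4 : √(2 * π * 2) = 2 * √π := by
      rw [show 2 * π * 2 = 2 ^ 2 * π by ring, Real.sqrt_mul (by norm_num)]
      simp
    simp only [gaussianPDFReal, smul_eq_mul, NNReal.coe_ofNat, h4, sub_zero, Real.rpow_one,
      Real.rpow_two, sq_abs]
    rw [show -x ^ 2 / (2 * 2) = -(1 / 4) * x ^ 2 by ring]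
    ring
  rw [integral_congr_ae (ae_of_all _ h1), integral_comp_abs
    (f := fun y : ℝ => (2 * √π)⁻¹ * (y ^ (1 : ℝ) * rexp (-(1 / 4) * y ^ (2 : ℝ)))), integral_const_mul,
    integral_rpow_mul_exp_neg_mul_rpow (by norm_num) (by norm_num) (by norm_num)]
  norm_num
  field_simp

lemma spe_key {Ω : Type*} [MeasurableSpace Ω] {P : Measure Ω} [IsProbabilityMeasure P]
    {X Z : Ω → ℝ} (h : HasGaussianLaw (fun ω => (X ω, Z ω)) P) (c : ℝ)
    (hX : ∫ ω, X ω ∂P = 0) (hZ : ∫ ω, Z ω ∂P = 0)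
    (hXX : cov[X, X; P] = 2) (hXZ : cov[X, Z; P] = 2 * c) :
    ∫ ω, Real.sign (X ω) * Z ω ∂P = c * (2 / √π) := by
  have gX := h.fst
  have gZ := h.snd
  have mX := gX.aemeasurable
  have mZ := gZ.aemeasurable
  have mS : AEMeasurable (fun ω => Real.sign (X ω)) P := spe_measurable_sign.comp_aemeasurable mX
  have hW : HasGaussianLaw (fun ω => (X ω, Z ω - c * X ω)) P := by
    have := h.map_fun ((ContinuousLinearMap.fst ℝ ℝ ℝ).prod
      (ContinuousLinearMap.snd ℝ ℝ ℝ - c • ContinuousLinearMap.fst ℝ ℝ ℝ))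
    simpa using this
  have iW : IndepFun X (fun ω => Z ω - c * X ω) P := by
    apply hW.indepFun_of_covariance_eq_zero
    rw [covariance_fun_sub_right gX.memLp_two gZ.memLp_two (gX.memLp_two.const_mul c),
      covariance_const_mul_right, hXX, hXZ]
    ring
  have iSW := iW.comp spe_measurable_sign measurable_id
  have e1 : ∫ ω, Real.sign (X ω) * (Z ω - c * X ω) ∂P = 0 := by
    have := iSW.integral_fun_mul_eq_mul_integral mS.aestronglyMeasurable
      hW.snd.aemeasurable.aestronglyMeasurable
    simp only [Function.comp_def, id] at this
    rw [this, integral_sub gZ.integrable (gX.integrable.const_mul c), integral_const_mul, hX, hZ]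
    simp
  have e2 : ∫ ω, |X ω| ∂P = 2 / √π := by
    have hl := gX.map_eq_gaussianReal
    rw [hX, ← covariance_self mX, hXX] at hl
    rw [← spe_abs_gaussian, show (2 : NNReal) = (2 : ℝ).toNNReal by simp, ← hl,
      integral_map mX (by fun_prop)]
  have e3 : ∀ ω, Real.sign (X ω) * Z ω = Real.sign (X ω) * (Z ω - c * X ω) + c * |X ω| := by
    intro ω
    rw [← spe_sign_mul_self]; ring
  simp_rw [e3]
  rw [integral_add, e1, integral_const_mul, e2, zero_add]
  · exact hW.snd.integrable.bdd_mul (c := 1) mS.aestronglyMeasurable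
      (ae_of_all _ fun _ => spe_sign_bound _)
  · exact gX.integrable.abs.const_mul c

lemma spe_coord {Ω : Type*} [MeasurableSpace Ω] {P : Measure Ω} [IsProbabilityMeasure P]
    {n : ℕ} {a : Ω → Fin n → ℝ}
    (ha : Measure.map a P = Measure.pi fun _ : Fin n => gaussianReal 0 1) :
    HasGaussianLaw a P ∧ (∀ i, HasGaussianLaw (fun ω => a ω i) P) ∧ (∀ i, ∫ ω, a ω i ∂P = 0) ∧
    ∀ i j, cov[fun ω => a ω i, fun ω => a ω j; P] = if i = j then 1 else 0 := by
  have hm : AEMeasurable a P := aemeasurable_of_map_neZero (by rw [ha]; infer_instance)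
  have hI : iIndepFun (fun (i : Fin n) (y : Fin n → ℝ) => y i)
      (Measure.pi fun _ : Fin n => gaussianReal 0 1) :=
    iIndepFun_pi (X := fun _ => id) (fun _ => aemeasurable_id)
  have hpi : IsGaussian (Measure.pi fun _ : Fin n => gaussianReal 0 1) := by
    have h1 : ∀ i, HasGaussianLaw (fun y : Fin n → ℝ => y i)
        (Measure.pi fun _ : Fin n => gaussianReal 0 1) := fun i => ⟨by
      have := (measurePreserving_eval (fun _ : Fin n => gaussianReal 0 1) i).map_eq
      change IsGaussian (Measure.map (Function.eval (β := fun _ : Fin n => ℝ) i) _)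
      rw [this]; infer_instance⟩
    have h2 := (hI.hasGaussianLaw h1).isGaussian_map
    have h3 : (fun (ω : Fin n → ℝ) => fun i => ω i) = id := rfl
    rwa [h3, Measure.map_id] at h2
  have g : HasGaussianLaw a P := ⟨by rw [ha]; exact hpi⟩
  have gi : ∀ i, HasGaussianLaw (fun ω => a ω i) P := fun i =>
    g.map_fun (ContinuousLinearMap.proj i)
  have hlaw : ∀ i, P.map (fun ω => a ω i) = gaussianReal 0 1 := by
    intro i
    have := (measurePreserving_eval (fun _ : Fin n => gaussianReal 0 1) i).map_eq
    rw [← ha, AEMeasurable.map_map_of_aemeasurable (measurable_pi_apply i).aemeasurable hm] at this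
    exact this
  refine ⟨g, gi, ?_, ?_⟩
  · intro i
    have : ∫ y, y ∂(P.map (fun ω => a ω i)) = ∫ ω, a ω i ∂P :=
      integral_map (gi i).aemeasurable (by fun_prop)
    rw [← this, hlaw]; simp
  · intro i j
    split_ifs with hij
    · subst hij
      rw [covariance_self (gi i).aemeasurable]
      have := variance_map (μ := P) (X := id) (Y := fun ω => a ω i) (by fun_prop)
        (gi i).aemeasurable
      rw [hlaw, variance_id_gaussianReal] at this
      simpa [Function.comp_def] using this.symm
    · have h0 := (hI.indepFun hij).covariance_eq_zero
        ((IsGaussian.hasGaussianLaw_id.map_fun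
          (ContinuousLinearMap.proj (R := ℝ) (φ := fun _ : Fin n => ℝ) i)).memLp_two)
        ((IsGaussian.hasGaussianLaw_id.map_fun
          (ContinuousLinearMap.proj (R := ℝ) (φ := fun _ : Fin n => ℝ) j)).memLp_two)
      rw [← ha, covariance_map_fun (measurable_pi_apply i).aestronglyMeasurable
        (measurable_pi_apply j).aestronglyMeasurable hm] at h0
      exact h0

/-- One factor: a Gaussian vector with centred coordinates and covariance `2 I`. -/
lemma spe_factor {Ω : Type*} [MeasurableSpace Ω] {P : Measure Ω} [IsProbabilityMeasure P]
    {n : ℕ} {d : Ω → Fin n → ℝ} (g : HasGaussianLaw d P)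
    (h0 : ∀ i, ∫ ω, d ω i ∂P = 0)
    (hc : ∀ i j, cov[fun ω => d ω i, fun ω => d ω j; P] = if i = j then 2 else 0)
    (u x : Fin n → ℝ) (hu : ∑ j, u j ^ 2 = 1) :
    ∫ ω, Real.sign (∑ j, d ω j * u j) * (∑ j, d ω j * x j) ∂P
      = (∑ j, u j * x j) * (2 / √π) := by
  have gi : ∀ i, HasGaussianLaw (fun ω => d ω i) P := fun i =>
    g.map_fun (ContinuousLinearMap.proj i)
  have hm : ∀ v : Fin n → ℝ, ∫ ω, ∑ j, d ω j * v j ∂P = 0 := by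
    intro v
    rw [integral_finsetSum _ fun i _ => (gi i).integrable.mul_const _]
    simp [integral_mul_const, h0]
  have hcv : ∀ v w : Fin n → ℝ, cov[fun ω => ∑ j, d ω j * v j, fun ω => ∑ j, d ω j * w j; P]
      = 2 * ∑ j, v j * w j := by
    intro v w
    rw [covariance_fun_sum_fun_sum (X := fun j ω => d ω j * v j) (Y := fun j ω => d ω j * w j)
      (fun i => (gi i).memLp_two.mul_const _) (fun i => (gi i).memLp_two.mul_const _)]
    simp_rw [covariance_mul_const_left, covariance_mul_const_right, hc]
    simp [Finset.mul_sum, mul_assoc, mul_comm]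
  refine spe_key ?_ _ (hm u) (hm x) ?_ (hcv u x)
  · have := g.map_fun ((∑ j, u j • ContinuousLinearMap.proj (R := ℝ) (φ := fun _ : Fin n => ℝ) j).prod
      (∑ j, x j • ContinuousLinearMap.proj (R := ℝ) (φ := fun _ : Fin n => ℝ) j))
    simpa [mul_comm] using this
  · rw [hcv]
    simp only [sq] at hu
    rw [hu, mul_one]

lemma spe_cov {Ω : Type*} [MeasurableSpace Ω] {P : Measure Ω} [IsProbabilityMeasure P]
    {X Y Z W : Ω → ℝ} (hX : MemLp X 2 P) (hY : MemLp Y 2 P) (hZ : MemLp Z 2 P) (hW : MemLp W 2 P)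
    (s t : ℝ) :
    cov[fun ω => X ω + s * Y ω, fun ω => Z ω + t * W ω; P]
      = cov[X, Z; P] + t * cov[X, W; P] + s * cov[Y, Z; P] + s * t * cov[Y, W; P] := by
  have hY' := hY.const_mul s
  have hW' := hW.const_mul t
  have h1 := covariance_add_left hX hY' (hZ.add hW')
  rw [covariance_add_right hX hZ hW', covariance_add_right hY' hZ hW', covariance_const_mul_left,
    covariance_const_mul_left, covariance_const_mul_right, covariance_const_mul_right] at h1
  refine Eq.trans h1 ?_
  ring

/-- For a unit vector `u ∈ ℝⁿ`, an arbitrary `x ∈ ℝⁿ`, and `a, b` independent standard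
Gaussian random vectors in `ℝⁿ`,
`E[sign(⟨a,u⟩² − ⟨b,u⟩²) · (⟨a,x⟩² − ⟨b,x⟩²)] = (4/π) ⟨u,x⟩²`. -/
theorem sign_product_expectation
    {Ω : Type*} [MeasureSpace Ω] [IsProbabilityMeasure (ℙ : Measure Ω)]
    {n : ℕ} (u x : Fin n → ℝ) (hu : ∑ j, u j ^ 2 = 1)
    (a b : Ω → Fin n → ℝ)
    (hab : IndepFun a b ℙ)
    (ha : Measure.map a ℙ = Measure.pi fun _ : Fin n => gaussianReal 0 1)
    (hb : Measure.map b ℙ = Measure.pi fun _ : Fin n => gaussianReal 0 1) :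
    ∫ ω, Real.sign ((∑ j, a ω j * u j) ^ 2 - (∑ j, b ω j * u j) ^ 2)
          * ((∑ j, a ω j * x j) ^ 2 - (∑ j, b ω j * x j) ^ 2) ∂ℙ
      = (4 / π) * (∑ j, u j * x j) ^ 2 := by
  obtain ⟨ga, gai, a0, ac⟩ := spe_coord ha
  obtain ⟨gb, gbi, b0, bc⟩ := spe_coord hb
  have cab : ∀ i j, cov[fun ω => a ω i, fun ω => b ω j; ℙ] = 0 := fun i j =>
    (hab.comp (measurable_pi_apply i) (measurable_pi_apply j)).covariance_eq_zero
      (gai i).memLp_two (gbi j).memLp_two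
  have cba : ∀ i j, cov[fun ω => b ω i, fun ω => a ω j; ℙ] = 0 := fun i j => by
    rw [covariance_comm, cab]
  have gab := hab.hasGaussianLaw ga gb
  have mai := fun i => (gai i).memLp_two
  have mbi := fun i => (gbi i).memLp_two
  have gds : HasGaussianLaw (fun ω => (fun i => a ω i - b ω i, fun i => a ω i + b ω i)) ℙ :=
    gab.map_fun (((ContinuousLinearMap.fst ℝ (Fin n → ℝ) (Fin n → ℝ)) -
      ContinuousLinearMap.snd ℝ (Fin n → ℝ) (Fin n → ℝ)).prod
      ((ContinuousLinearMap.fst ℝ (Fin n → ℝ) (Fin n → ℝ)) +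
      ContinuousLinearMap.snd ℝ (Fin n → ℝ) (Fin n → ℝ)))
  have ids : IndepFun (fun ω i => a ω i - b ω i) (fun ω i => a ω i + b ω i) ℙ := by
    refine HasGaussianLaw.indepFun_of_covariance_eval (X := fun i ω => a ω i - b ω i)
      (Y := fun i ω => a ω i + b ω i) gds fun i j => ?_
    have := spe_cov (mai i) (mbi i) (mai j) (mbi j) (-1) (1)
    rw [ac, bc, cab, cba] at this
    simp only [neg_mul, one_mul, ← sub_eq_add_neg] at this
    rw [this]
    ring
  have fd := spe_factor gds.fst
    (fun i => by
      rw [integral_sub (gai i).integrable (gbi i).integrable, a0, b0, sub_zero])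
    (fun i j => by
      have := spe_cov (mai i) (mbi i) (mai j) (mbi j) (-1) (-1)
      rw [ac, bc, cab, cba] at this
      simp only [neg_mul, one_mul, ← sub_eq_add_neg] at this
      rw [this]
      split_ifs <;> norm_num) u x hu
  have fs := spe_factor gds.snd
    (fun i => by
      rw [integral_add (gai i).integrable (gbi i).integrable, a0, b0, add_zero])
    (fun i j => by
      have := spe_cov (mai i) (mbi i) (mai j) (mbi j) (1) (1)
      rw [ac, bc, cab, cba] at this
      simp only [neg_mul, one_mul, ← sub_eq_add_neg] at this
      rw [this]
      split_ifs <;> norm_num) u x hu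
  have mF : Measurable (fun v : Fin n → ℝ => Real.sign (∑ j, v j * u j) * ∑ j, v j * x j) :=
    (spe_measurable_sign.comp (by fun_prop)).mul (by fun_prop)
  have hprod := (ids.comp mF mF).integral_fun_mul_eq_mul_integral
    (mF.comp_aemeasurable gds.fst.aemeasurable).aestronglyMeasurable
    (mF.comp_aemeasurable gds.snd.aemeasurable).aestronglyMeasurable
  simp only [Function.comp_def] at hprod
  rw [fd, fs] at hprod
  have e : ∀ (ω : Ω), Real.sign ((∑ j, a ω j * u j) ^ 2 - (∑ j, b ω j * u j) ^ 2)
          * ((∑ j, a ω j * x j) ^ 2 - (∑ j, b ω j * x j) ^ 2)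
      = (Real.sign (∑ j, (a ω j - b ω j) * u j) * ∑ j, (a ω j - b ω j) * x j) *
        (Real.sign (∑ j, (a ω j + b ω j) * u j) * ∑ j, (a ω j + b ω j) * x j) := by
    intro ω
    simp only [sub_mul, add_mul, Finset.sum_sub_distrib, Finset.sum_add_distrib]
    rw [show ∀ r s : ℝ, r ^ 2 - s ^ 2 = (r - s) * (r + s) from fun r s => by ring, spe_sign_mul]
    ring
  simp_rw [e]
  rw [hprod]
  have hp : √π ^ 2 = π := Real.sq_sqrt Real.pi_pos.le
  rw [show (4 : ℝ) / π = 4 / √π ^ 2 by rw [hp]]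
  field_simp
  ring
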